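/- Let Λ ⊆ ℍ be an axially symmetric s-domain and let 𝐢, 𝐣 ∈ 𝕊² with 𝐢 ⊥ 𝐣 (so that {1, 𝐢, 𝐣, 𝐢𝐣} is a real basis of ℍ). Then every slice regular f : Λ → ℍ can be written uniquely as f(q) = f₀(q) + f₁(q)·𝐢 + f₂(q)·𝐣 + f₃(q)·𝐢𝐣 for all q ∈ Λ, where each fₗ : Λ → ℍ (ℓ = 0,1,2,3) is slice regular on Λ and satisfies the quaternionic C-property; uniqueness means any two such quadruples agree on Λ. (That is, 𝒮ℛ(Λ) = 𝒮ℛ_c(Λ) ⊕ 𝒮ℛ_c(Λ)𝐢 ⊕ 𝒮ℛ_c(Λ)𝐣 ⊕ 𝒮ℛ_c(Λ)𝐢𝐣.) -/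

import Mathlib

open MeasureTheory Complex Quaternion

noncomputable section

/-- The sphere of imaginary units of the quaternions. -/
def Sph : Set ℍ[ℝ] := {I | I.re = 0 ∧ ‖I‖ = 1}

/-- `Λ ⊆ ℍ` is axially symmetric. -/
def AxSymm (Λ : Set ℍ[ℝ]) : Prop :=
  ∀ (x y : ℝ), (∃ J ∈ Sph, (x : ℍ[ℝ]) + y • J ∈ Λ) → ∀ I ∈ Sph, (x : ℍ[ℝ]) + y • I ∈ Λ

/-- The complex plane `ℂ(I) = {x + yI : x, y ∈ ℝ}` inside the quaternions. -/
def CSlice (I : ℍ[ℝ]) : Set ℍ[ℝ] := {q | ∃ x y : ℝ, q = (x : ℍ[ℝ]) + y • I}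

/-- `Λ` is an s-domain: an open connected set intersecting the real axis whose
intersection with each slice `ℂ(I)` is connected. -/
def IsSDomain (Λ : Set ℍ[ℝ]) : Prop :=
  IsOpen Λ ∧ IsConnected Λ ∧ (∃ r : ℝ, (r : ℍ[ℝ]) ∈ Λ) ∧
    ∀ I ∈ Sph, IsConnected (Λ ∩ CSlice I)

/-- `f` is (left) slice regular on `Λ`: it is real-differentiable on `Λ` and on each
slice it satisfies `∂f/∂x + I ∂f/∂y = 0`. -/
def SliceRegular (Λ : Set ℍ[ℝ]) (f : ℍ[ℝ] → ℍ[ℝ]) : Prop :=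
  DifferentiableOn ℝ f Λ ∧
  ∀ I ∈ Sph, ∀ x y : ℝ, (x : ℍ[ℝ]) + y • I ∈ Λ →
    deriv (fun t : ℝ => f ((t : ℍ[ℝ]) + y • I)) x
      + I * deriv (fun t : ℝ => f ((x : ℍ[ℝ]) + t • I)) y = 0

/-- The quaternionic C-property of a function on `Λ`. -/
def QCProp (Λ : Set ℍ[ℝ]) (f : ℍ[ℝ] → ℍ[ℝ]) : Prop :=
  ∀ q ∈ Λ, f (star q) = star (f q)

/-- The slice `Ω_𝐢 ⊆ ℂ` of `Λ` in the plane determined by `𝐢`. -/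
def SliceSet (Λ : Set ℍ[ℝ]) (i : ℍ[ℝ]) : Set ℂ :=
  {z | (z.re : ℍ[ℝ]) + z.im • i ∈ Λ}

/-- The embedding `ι : ℂ → ℂ(𝐢) ⊆ ℍ`, `a + b i ↦ a + b 𝐢`. -/
def toSlice (i : ℍ[ℝ]) (z : ℂ) : ℍ[ℝ] := (z.re : ℍ[ℝ]) + z.im • i

/-- `Ω` is invariant under complex conjugation. -/
def ZInvariant (Ω : Set ℂ) : Prop := ∀ z ∈ Ω, (starRingEnd ℂ) z ∈ Ω

/-- `f` is holomorphic on `Ω`: complex-differentiable at every point of `Ω`. -/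
def HolomorphicOn (Ω : Set ℂ) (f : ℂ → ℂ) : Prop := ∀ z ∈ Ω, DifferentiableAt ℂ f z

/-- `f` satisfies the C-property on `Ω`. -/
def CProp (Ω : Set ℂ) (f : ℂ → ℂ) : Prop := ∀ z ∈ Ω, f ((starRingEnd ℂ) z) = (starRingEnd ℂ) (f z)

/-- `f` satisfies the anti-C-property on `Ω`. -/
def AntiCProp (Ω : Set ℂ) (f : ℂ → ℂ) : Prop := ∀ z ∈ Ω, f ((starRingEnd ℂ) z) = -(starRingEnd ℂ) (f z)

theorem mem_Sph_iff_star {I : ℍ[ℝ]} : I ∈ Sph ↔ star I = -I ∧ I * I = -1 := by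
  have key : star I = -I → (‖I‖ = 1 ↔ I * I = -1) := fun h => by
    have h1 : -(I * I) = ((‖I‖ * ‖I‖ : ℝ) : ℍ[ℝ]) := by
      rw [← Quaternion.normSq_eq_norm_mul_self, ← Quaternion.self_mul_star, h, mul_neg]
    rw [← neg_eq_iff_eq_neg, h1, ← Quaternion.coe_one, Quaternion.coe_inj,
      mul_self_eq_one_iff]
    constructor
    · exact Or.inl
    · rintro (h | h)
      · exact h
      · linarith [norm_nonneg I]
  exact (and_congr_left' Quaternion.star_eq_neg.symm).trans (and_congr_right key)

theorem coe_eq_smul_one (x : ℝ) : (x : ℍ[ℝ]) = x • (1 : ℍ[ℝ]) := by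
  rw [← Quaternion.coe_mul_eq_smul, mul_one]

theorem neg_mem_Sph {I : ℍ[ℝ]} (hI : I ∈ Sph) : -I ∈ Sph :=
  ⟨by simp [hI.1], by rw [norm_neg, hI.2]⟩

theorem conj_mem_Sph {I u : ℍ[ℝ]} (hI : I ∈ Sph) (hu : star u * u = 1) (hu' : u * star u = 1) :
    u * I * star u ∈ Sph := by
  rw [mem_Sph_iff_star] at hI ⊢
  constructor
  · simp [hI.1, mul_assoc]
  · calc u * I * star u * (u * I * star u) = u * I * (star u * u) * I * star u := by noncomm_ring
      _ = u * (I * I) * star u := by rw [hu]; noncomm_ring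
      _ = -1 := by rw [hI.2, mul_neg, mul_one, neg_mul, hu']

/-- Every quaternion lies in some slice. -/
theorem exists_eq_add_smul_mem_Sph {i : ℍ[ℝ]} (hi : i ∈ Sph) (q : ℍ[ℝ]) :
    ∃ (x y : ℝ), ∃ I ∈ Sph, q = (x : ℍ[ℝ]) + y • I := by
  by_cases h : q.im = 0
  · exact ⟨q.re, 0, i, hi, by rw [zero_smul, ← h, Quaternion.re_add_im]⟩
  · have hn : ‖q.im‖ ≠ 0 := norm_ne_zero_iff.2 h
    refine ⟨q.re, ‖q.im‖, ‖q.im‖⁻¹ • q.im, ⟨by simp, ?_⟩, ?_⟩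
    · rw [norm_smul, norm_inv, norm_norm, inv_mul_cancel₀ hn]
    · rw [smul_inv_smul₀ hn, Quaternion.re_add_im]

theorem star_add_smul {I : ℍ[ℝ]} (hI : I ∈ Sph) (x y : ℝ) :
    star ((x : ℍ[ℝ]) + y • I) = (x : ℍ[ℝ]) + (-y) • I := by
  rw [star_add, Quaternion.star_coe, Quaternion.star_smul, (mem_Sph_iff_star.1 hI).1, smul_neg,
    neg_smul]

theorem AxSymm.star_mem {Λ : Set ℍ[ℝ]} (hax : AxSymm Λ) {I : ℍ[ℝ]} (hI : I ∈ Sph) {x y : ℝ}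
    (h : (x : ℍ[ℝ]) + y • I ∈ Λ) : (x : ℍ[ℝ]) + (-y) • I ∈ Λ := by
  rw [neg_smul, ← smul_neg]
  exact hax x y ⟨I, hI, h⟩ _ (neg_mem_Sph hI)

theorem conj_add_smul {u : ℍ[ℝ]} (hu' : u * star u = 1) (x y : ℝ) (I : ℍ[ℝ]) :
    u * ((x : ℍ[ℝ]) + y • I) * star u = (x : ℍ[ℝ]) + y • (u * I * star u) := by
  rw [mul_add, add_mul, ← Quaternion.coe_commutes, mul_assoc, hu', mul_one, mul_smul_comm,
    smul_mul_assoc]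

theorem AxSymm.conj_mem {Λ : Set ℍ[ℝ]} (hax : AxSymm Λ) {i u q : ℍ[ℝ]} (hi : i ∈ Sph)
    (hu : star u * u = 1) (hu' : u * star u = 1) (hq : q ∈ Λ) : u * q * star u ∈ Λ := by
  obtain ⟨x, y, I, hI, rfl⟩ := exists_eq_add_smul_mem_Sph hi q
  rw [conj_add_smul hu']
  exact hax x y ⟨I, hI, hq⟩ _ (conj_mem_Sph hI hu hu')

/-- On an open set, slice regularity is a Cauchy–Riemann condition on the real differential. -/
theorem sliceRegular_iff_fderiv {Λ : Set ℍ[ℝ]} (hΛ : IsOpen Λ) {f : ℍ[ℝ] → ℍ[ℝ]} :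
    SliceRegular Λ f ↔ (∀ q ∈ Λ, DifferentiableAt ℝ f q) ∧
      ∀ I ∈ Sph, ∀ x y : ℝ, (x : ℍ[ℝ]) + y • I ∈ Λ →
        fderiv ℝ f ((x : ℍ[ℝ]) + y • I) 1 + I * fderiv ℝ f ((x : ℍ[ℝ]) + y • I) I = 0 := by
  have hd : DifferentiableOn ℝ f Λ ↔ ∀ q ∈ Λ, DifferentiableAt ℝ f q :=
    ⟨fun h q hq => h.differentiableAt (hΛ.mem_nhds hq),
      fun h q hq => (h q hq).differentiableWithinAt⟩
  refine (and_congr_left' hd).trans (and_congr_right fun h => ?_)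
  refine forall₅_congr fun I hI x y hq => ?_
  have hf := (h _ hq).hasFDerivAt
  have h1 : HasDerivAt (fun t : ℝ => (t : ℍ[ℝ]) + y • I) 1 x := by
    have : HasDerivAt (fun t : ℝ => t • (1 : ℍ[ℝ]) + y • I) ((1 : ℝ) • (1 : ℍ[ℝ])) x :=
      ((hasDerivAt_id x).smul_const _).add_const _
    simpa [coe_eq_smul_one] using this
  have h2 : HasDerivAt (fun t : ℝ => (x : ℍ[ℝ]) + t • I) I y := by
    simpa using ((hasDerivAt_id y).smul_const I).const_add (x : ℍ[ℝ])
  have e1 := (hf.comp_hasDerivAt x h1).deriv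
  have e2 := (hf.comp_hasDerivAt y h2).deriv
  simp only [Function.comp_def] at e1 e2
  rw [e1, e2]

theorem SliceRegular.add {Λ : Set ℍ[ℝ]} (hΛ : IsOpen Λ) {f g : ℍ[ℝ] → ℍ[ℝ]}
    (hf : SliceRegular Λ f) (hg : SliceRegular Λ g) : SliceRegular Λ (f + g) := by
  rw [sliceRegular_iff_fderiv hΛ] at *
  refine ⟨fun q hq => (hf.1 q hq).add (hg.1 q hq), fun I hI x y hq => ?_⟩
  rw [fderiv_add (hf.1 _ hq) (hg.1 _ hq)]
  have h1 := hf.2 I hI x y hq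
  have h2 := hg.2 I hI x y hq
  simp only [_root_.add_apply, mul_add]
  rw [add_add_add_comm, h1, h2, add_zero]

theorem SliceRegular.sub {Λ : Set ℍ[ℝ]} (hΛ : IsOpen Λ) {f g : ℍ[ℝ] → ℍ[ℝ]}
    (hf : SliceRegular Λ f) (hg : SliceRegular Λ g) : SliceRegular Λ (f - g) := by
  rw [sliceRegular_iff_fderiv hΛ] at *
  refine ⟨fun q hq => (hf.1 q hq).sub (hg.1 q hq), fun I hI x y hq => ?_⟩
  rw [fderiv_sub (hf.1 _ hq) (hg.1 _ hq)]
  have h1 := hf.2 I hI x y hq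
  have h2 := hg.2 I hI x y hq
  simp only [_root_.sub_apply, mul_sub]
  rw [sub_add_sub_comm, h1, h2, sub_zero]

theorem SliceRegular.mul_const {Λ : Set ℍ[ℝ]} (hΛ : IsOpen Λ) {f : ℍ[ℝ] → ℍ[ℝ]}
    (hf : SliceRegular Λ f) (c : ℍ[ℝ]) : SliceRegular Λ (fun q => f q * c) := by
  rw [sliceRegular_iff_fderiv hΛ] at *
  refine ⟨fun q hq => (hf.1 q hq).mul_const c, fun I hI x y hq => ?_⟩
  rw [((hf.1 _ hq).hasFDerivAt.mul_const' c).fderiv]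
  simp only [_root_.smul_apply, MulOpposite.smul_eq_mul_unop, MulOpposite.unop_op]
  rw [← mul_assoc, ← add_mul, hf.2 I hI x y hq, zero_mul]

/-- Slice regularity is preserved when a rotation acts on both the variable and the value. -/
theorem SliceRegular.conj {Λ : Set ℍ[ℝ]} (hΛ : IsOpen Λ) (hax : AxSymm Λ) {f : ℍ[ℝ] → ℍ[ℝ]}
    (hf : SliceRegular Λ f) {i u : ℍ[ℝ]} (hi : i ∈ Sph) (hu : star u * u = 1)
    (hu' : u * star u = 1) :
    SliceRegular Λ (fun q => star u * f (u * q * star u) * u) := by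
  rw [sliceRegular_iff_fderiv hΛ] at *
  have hD : ∀ q ∈ Λ, HasFDerivAt (fun q => star u * f (u * q * star u) * u)
      ((ContinuousLinearMap.mulLeftRight ℝ ℍ[ℝ] (star u) u).comp
        ((fderiv ℝ f (u * q * star u)).comp
          (ContinuousLinearMap.mulLeftRight ℝ ℍ[ℝ] u (star u)))) q := fun q hq => by
    have h1 := (ContinuousLinearMap.mulLeftRight ℝ ℍ[ℝ] u (star u)).hasFDerivAt (x := q)
    have h2 := (hf.1 _ (hax.conj_mem hi hu hu' hq)).hasFDerivAt
    exact (ContinuousLinearMap.mulLeftRight ℝ ℍ[ℝ] (star u) u).hasFDerivAt.comp q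
      (HasFDerivAt.comp q h2 h1)
  refine ⟨fun q hq => (hD q hq).differentiableAt, fun I hI x y hq => ?_⟩
  have hq' := hax.conj_mem hi hu hu' hq
  rw [(hD _ hq).fderiv]
  rw [conj_add_smul hu'] at hq' ⊢
  have h := hf.2 _ (conj_mem_Sph hI hu hu') x y hq'
  simp only [ContinuousLinearMap.comp_apply, ContinuousLinearMap.mulLeftRight_apply, mul_one, hu']
  set A := fderiv ℝ f ((x : ℍ[ℝ]) + y • (u * I * star u))
  calc star u * A 1 * u + I * (star u * A (u * I * star u) * u)
      = star u * A 1 * u + (star u * u) * I * (star u * A (u * I * star u) * u) := by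
        rw [hu, one_mul]
    _ = star u * (A 1 + (u * I * star u) * A (u * I * star u)) * u := by noncomm_ring
    _ = 0 := by rw [h, mul_zero, zero_mul]

/-- For `I * I = -1` this intertwines left multiplication by `I` with multiplication by the complex
imaginary unit. -/
def sliceCoord (I c : ℍ[ℝ]) : ℍ[ℝ] →L[ℝ] ℂ :=
  LinearMap.toContinuousLinearMap
    { toFun := fun q => ⟨(q * c).re, -(I * (q * c)).re⟩
      map_add' := fun p q => by
        apply Complex.ext <;> simp only [add_mul, mul_add, Quaternion.re_add, Complex.add_re,
          Complex.add_im]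
        ring
      map_smul' := fun r q => by
        apply Complex.ext <;> simp [-Quaternion.re_mul] }

theorem sliceCoord_apply (I c q : ℍ[ℝ]) :
    sliceCoord I c q = ⟨(q * c).re, -(I * (q * c)).re⟩ := rfl

theorem sliceCoord_mul {I : ℍ[ℝ]} (hI : I ∈ Sph) (c q : ℍ[ℝ]) :
    sliceCoord I c (I * q) = Complex.I * sliceCoord I c q := by
  have h : I * (I * q * c) = -(q * c) := by
    rw [mul_assoc, ← mul_assoc I I, (mem_Sph_iff_star.1 hI).2, neg_one_mul]
  rw [mul_assoc] at h
  apply Complex.ext <;> simp [sliceCoord_apply, h, mul_assoc I q c, -Quaternion.re_mul]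

theorem sliceCoord_one_toSlice {I : ℍ[ℝ]} (hI : I ∈ Sph) (z : ℂ) :
    sliceCoord I 1 (toSlice I z) = z := by
  have h := (mem_Sph_iff_star.1 hI).2
  apply Complex.ext <;>
    simp [sliceCoord_apply, toSlice, hI.1, mul_add, h, -Quaternion.re_mul,
      Quaternion.mul_coe_eq_smul]

/-- `toSlice` as a continuous linear map. -/
def toSliceCLM (I : ℍ[ℝ]) : ℂ →L[ℝ] ℍ[ℝ] :=
  Complex.reCLM.smulRight 1 + Complex.imCLM.smulRight I

theorem toSliceCLM_apply (I : ℍ[ℝ]) (z : ℂ) : toSliceCLM I z = toSlice I z := by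
  simp [toSliceCLM, toSlice, coe_eq_smul_one]

theorem isOpen_sliceSet {Λ : Set ℍ[ℝ]} (hΛ : IsOpen Λ) (I : ℍ[ℝ]) : IsOpen (SliceSet Λ I) := by
  have h : SliceSet Λ I = toSliceCLM I ⁻¹' Λ := by
    ext z
    rw [Set.mem_preimage, toSliceCLM_apply]
    rfl
  rw [h]
  exact hΛ.preimage (toSliceCLM I).continuous

theorem IsSDomain.isPreconnected_sliceSet {Λ : Set ℍ[ℝ]} (hs : IsSDomain Λ) {I : ℍ[ℝ]}
    (hI : I ∈ Sph) : IsPreconnected (SliceSet Λ I) := by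
  have h : SliceSet Λ I = sliceCoord I 1 '' (Λ ∩ CSlice I) := by
    ext z
    constructor
    · exact fun hz => ⟨toSlice I z, ⟨hz, z.re, z.im, rfl⟩, sliceCoord_one_toSlice hI z⟩
    · rintro ⟨_, ⟨hq, x, y, rfl⟩, rfl⟩
      have := sliceCoord_one_toSlice hI ⟨x, y⟩
      rw [toSlice] at this
      rw [this]
      exact hq
  rw [h]
  exact (hs.2.2.2 I hI).isPreconnected.image _ (sliceCoord I 1).continuous.continuousOn

/-- Identity theorem on a slice: the real axis is a set of uniqueness. -/
theorem IsSDomain.eqOn_sliceSet {Λ : Set ℍ[ℝ]} (hs : IsSDomain Λ) {I : ℍ[ℝ]} (hI : I ∈ Sph)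
    {φ ψ : ℂ → ℂ} (hφ : DifferentiableOn ℂ φ (SliceSet Λ I))
    (hψ : DifferentiableOn ℂ ψ (SliceSet Λ I))
    (h : ∀ x : ℝ, (x : ℍ[ℝ]) ∈ Λ → φ x = ψ x) : Set.EqOn φ ψ (SliceSet Λ I) := by
  have hO := isOpen_sliceSet hs.1 I
  obtain ⟨r, hr⟩ := hs.2.2.1
  have hr' : (r : ℂ) ∈ SliceSet Λ I := by simpa [SliceSet] using hr
  refine (hφ.analyticOnNhd hO).eqOn_of_preconnected_of_frequently_eq (hψ.analyticOnNhd hO)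
    (hs.isPreconnected_sliceSet hI) hr' ?_
  have ht : Filter.Tendsto (fun x : ℝ => (x : ℂ)) (nhdsWithin r {r}ᶜ)
      (nhdsWithin (r : ℂ) {(r : ℂ)}ᶜ) :=
    Complex.continuous_ofReal.continuousAt.continuousWithinAt.tendsto_nhdsWithin
      fun x hx => by simpa using hx
  refine ht.frequently (Filter.Eventually.frequently ?_)
  have ho : ∀ᶠ x : ℝ in nhds r, (x : ℍ[ℝ]) ∈ Λ :=
    Quaternion.continuous_coe.continuousAt.eventually (hs.1.mem_nhds hr)
  exact (ho.filter_mono nhdsWithin_le_nhds).mono fun x hx => h x hx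

theorem SliceRegular.differentiableOn_sliceCoord {Λ : Set ℍ[ℝ]} (hΛ : IsOpen Λ)
    {f : ℍ[ℝ] → ℍ[ℝ]} (hf : SliceRegular Λ f) {I : ℍ[ℝ]} (hI : I ∈ Sph) (c : ℍ[ℝ]) :
    DifferentiableOn ℂ (fun z => sliceCoord I c (f (toSlice I z))) (SliceSet Λ I) := by
  rw [sliceRegular_iff_fderiv hΛ] at hf
  intro z hz
  have hfz := (hf.1 _ hz).hasFDerivAt
  have hcr := hf.2 I hI z.re z.im hz
  have h1 : HasFDerivAt (toSlice I) (toSliceCLM I) z := by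
    have := (toSliceCLM I).hasFDerivAt (x := z)
    rwa [funext (toSliceCLM_apply I)] at this
  have hD : HasFDerivAt (fun z => sliceCoord I c (f (toSlice I z))) _ z :=
    (sliceCoord I c).hasFDerivAt.comp z (HasFDerivAt.comp z hfz h1)
  refine (differentiableAt_complex_iff_differentiableAt_real.2
    ⟨hD.differentiableAt, ?_⟩).differentiableWithinAt
  rw [hD.fderiv]
  simp only [ContinuousLinearMap.comp_apply, toSliceCLM_apply]
  have e1 : toSlice I 1 = 1 := by simp [toSlice]
  have eI : toSlice I Complex.I = I := by simp [toSlice]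
  rw [e1, eI, smul_eq_mul, eq_neg_of_add_eq_zero_left hcr, map_neg, sliceCoord_mul hI, mul_neg,
    ← mul_assoc, Complex.I_mul_I, neg_one_mul, neg_neg]

theorem ext_re_mul {p q : ℍ[ℝ]} (h : ∀ c, (p * c).re = (q * c).re) : p = q := by
  have h0 := h (star (p - q))
  have h1 : ((p - q) * star (p - q)).re = 0 := by
    rw [sub_mul, Quaternion.re_sub, h0, sub_self]
  rw [Quaternion.self_mul_star, Quaternion.re_coe, Quaternion.normSq_eq_zero] at h1
  exact sub_eq_zero.1 h1

/-- A slice regular function vanishing on the real axis vanishes. -/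
theorem SliceRegular.eq_zero_of_real {Λ : Set ℍ[ℝ]} (hs : IsSDomain Λ) {f : ℍ[ℝ] → ℍ[ℝ]}
    (hf : SliceRegular Λ f) {i : ℍ[ℝ]} (hi : i ∈ Sph)
    (h : ∀ x : ℝ, (x : ℍ[ℝ]) ∈ Λ → f x = 0) : ∀ q ∈ Λ, f q = 0 := by
  intro q hq
  obtain ⟨x, y, I, hI, rfl⟩ := exists_eq_add_smul_mem_Sph hi q
  refine ext_re_mul fun c => ?_
  have key := hs.eqOn_sliceSet hI (hf.differentiableOn_sliceCoord hs.1 hI c)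
    (differentiableOn_const 0) (fun x hx => by simp [toSlice, h x hx])
    (show (⟨x, y⟩ : ℂ) ∈ SliceSet Λ I from hq)
  simpa [sliceCoord_apply, toSlice, -Quaternion.re_mul] using congrArg Complex.re key

/-- A slice regular function that is real on the real axis has the C-property. -/
theorem SliceRegular.qcProp_of_real {Λ : Set ℍ[ℝ]} (hs : IsSDomain Λ) (hax : AxSymm Λ)
    {f : ℍ[ℝ] → ℍ[ℝ]} (hf : SliceRegular Λ f) {i : ℍ[ℝ]} (hi : i ∈ Sph)
    (h : ∀ x : ℝ, (x : ℍ[ℝ]) ∈ Λ → ∃ r : ℝ, f x = r) : QCProp Λ f := by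
  intro q hq
  obtain ⟨x, y, I, hI, rfl⟩ := exists_eq_add_smul_mem_Sph hi q
  have key : ∀ y : ℝ, (x : ℍ[ℝ]) + y • I ∈ Λ →
      f ((x : ℍ[ℝ]) + y • I) = ((f ((x : ℍ[ℝ]) + (-y) • I)).re : ℍ[ℝ])
        + (I * f ((x : ℍ[ℝ]) + (-y) • I)).re • I := fun y hq => by
    refine ext_re_mul fun c => ?_
    set φ : ℂ → ℂ := fun z => sliceCoord I 1 (f (toSlice I z)) with hφ
    have hφd : DifferentiableOn ℂ φ (SliceSet Λ I) := hf.differentiableOn_sliceCoord hs.1 hI 1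
    have hO := isOpen_sliceSet hs.1 I
    have hψd : DifferentiableOn ℂ (fun z => (starRingEnd ℂ) (φ ((starRingEnd ℂ) z)) *
        sliceCoord I c 1) (SliceSet Λ I) := fun z hz => by
      have hz' : (starRingEnd ℂ) z ∈ SliceSet Λ I := hax.star_mem hI hz
      have h1 : DifferentiableAt ℂ φ ((starRingEnd ℂ) z) :=
        (hφd _ hz').differentiableAt (hO.mem_nhds hz')
      have h2 := h1.conj_conj
      rw [Complex.conj_conj] at h2
      exact (h2.mul_const _).differentiableWithinAt
    have e := hs.eqOn_sliceSet hI (hf.differentiableOn_sliceCoord hs.1 hI c) hψd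
      (fun t ht => by
        obtain ⟨r, hr⟩ := h t ht
        have : toSlice I (t : ℂ) = t := by simp [toSlice]
        simp only [hφ, Complex.conj_ofReal, this, hr]
        apply Complex.ext <;>
          simp [sliceCoord_apply, hI.1, Quaternion.coe_mul_eq_smul, -Quaternion.re_mul,
            Quaternion.mul_coe_eq_smul])
      (show (⟨x, y⟩ : ℂ) ∈ SliceSet Λ I from hq)
    have e := congrArg Complex.re e
    simp only [hφ, sliceCoord_apply, toSlice, Complex.mul_re, Complex.conj_re, Complex.conj_im,
      mul_one, one_mul] at e
    rw [e, add_mul, Quaternion.re_add, Quaternion.coe_mul_eq_smul, smul_mul_assoc,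
      Quaternion.re_smul, Quaternion.re_smul, smul_eq_mul, smul_eq_mul]
    ring
  have hq' := hax.star_mem hI hq
  have k1 := key y hq
  have k2 := key (-y) hq'
  rw [neg_neg] at k2
  rw [star_add_smul hI]
  set a := f ((x : ℍ[ℝ]) + y • I)
  set b := f ((x : ℍ[ℝ]) + (-y) • I)
  have r1 : a.re = b.re := by
    have := congrArg QuaternionAlgebra.re k1
    simpa [hI.1] using this
  have r2 : (I * a).re = -(I * b).re := by
    have := congrArg (fun p => (I * p).re) k1
    simpa [hI.1, mul_add, (mem_Sph_iff_star.1 hI).2, -Quaternion.re_mul,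
      Quaternion.mul_coe_eq_smul] using this
  rw [k1, star_add_smul hI, ← r2, ← r1]
  exact k2

theorem mul_rules_of_anticomm {i j : ℍ[ℝ]} (hi : i ∈ Sph) (hj : j ∈ Sph)
    (hperp : i * j = -(j * i)) :
    i * i = -1 ∧ j * j = -1 ∧ j * i = -(i * j) ∧ (∀ a, i * (i * a) = -a) ∧
      (∀ a, j * (j * a) = -a) ∧ ∀ a, j * (i * a) = -(i * (j * a)) := by
  have hji : j * i = -(i * j) := by rw [hperp, neg_neg]
  have hii := (mem_Sph_iff_star.1 hi).2
  have hjj := (mem_Sph_iff_star.1 hj).2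
  refine ⟨hii, hjj, hji, fun a => ?_, fun a => ?_, fun a => ?_⟩
  · rw [← mul_assoc, hii, neg_one_mul]
  · rw [← mul_assoc, hjj, neg_one_mul]
  · rw [← mul_assoc, hji, neg_mul, mul_assoc]

theorem star_mul_of_anticomm {i j : ℍ[ℝ]} (hi : i ∈ Sph) (hj : j ∈ Sph)
    (hperp : i * j = -(j * i)) : star (i * j) = -(i * j) := by
  rw [star_mul, (mem_Sph_iff_star.1 hi).1, (mem_Sph_iff_star.1 hj).1, neg_mul_neg, hperp, neg_neg]

theorem mul_mem_Sph_of_anticomm {i j : ℍ[ℝ]} (hi : i ∈ Sph) (hj : j ∈ Sph)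
    (hperp : i * j = -(j * i)) : i * j ∈ Sph :=
  ⟨Quaternion.star_eq_neg.1 (star_mul_of_anticomm hi hj hperp),
    by rw [norm_mul, hi.2, hj.2, one_mul]⟩

/-- A quaternion commuting with two anticommuting imaginary units is real. -/
theorem eq_re_of_commute {i j a : ℍ[ℝ]} (hi : i ∈ Sph) (hj : j ∈ Sph)
    (hperp : i * j = -(j * i)) (h1 : i * a = a * i) (h2 : j * a = a * j) :
    a = (a.re : ℍ[ℝ]) := by
  have key : ∀ u ∈ Sph, u * a = a * u → ∃ r : ℝ, a.im = r • u := fun u hu h => by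
    have hv : u * a.im = a.im * u := by
      rw [← Quaternion.sub_re_self, mul_sub, sub_mul, h, Quaternion.coe_commutes]
    have hr : star (a.im * u) = a.im * u := by
      rw [star_mul, (mem_Sph_iff_star.1 hu).1, Quaternion.star_im, neg_mul_neg, hv]
    refine ⟨-(a.im * u).re, ?_⟩
    rw [Quaternion.star_eq_self] at hr
    calc a.im = -(a.im * u * u) := by rw [mul_assoc, (mem_Sph_iff_star.1 hu).2]; simp
      _ = _ := by rw [hr, Quaternion.coe_mul_eq_smul, Quaternion.re_coe, neg_smul]
  obtain ⟨r, hr⟩ := key i hi h1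
  obtain ⟨s, hs⟩ := key j hj h2
  have h3 : (r • (i * j)).re = -s := by
    rw [← smul_mul_assoc, ← hr, hs, smul_mul_assoc, (mem_Sph_iff_star.1 hj).2]
    simp
  rw [Quaternion.re_smul, (mul_mem_Sph_of_anticomm hi hj hperp).1, smul_zero, zero_eq_neg] at h3
  have h4 : a.im = 0 := by rw [hs, h3, zero_smul]
  rw [← Quaternion.sub_re_self, sub_eq_zero] at h4
  exact h4

/-- Averaging a function over the rotations by the quaternion units `1, i, j, ij`, acting on both the
variable and the value, extracts its intrinsic part. -/
def intrinsicPart (i j : ℍ[ℝ]) (f : ℍ[ℝ] → ℍ[ℝ]) (q : ℍ[ℝ]) : ℍ[ℝ] :=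
  (f q + star i * f (i * q * star i) * i + star j * f (j * q * star j) * j
    + star (i * j) * f ((i * j) * q * star (i * j)) * (i * j)) * ((1 / 4 : ℝ) : ℍ[ℝ])

theorem star_mul_self_of_mem_Sph {u : ℍ[ℝ]} (hu : u ∈ Sph) : star u * u = 1 := by
  rw [(mem_Sph_iff_star.1 hu).1, neg_mul, (mem_Sph_iff_star.1 hu).2, neg_neg]

theorem mul_star_self_of_mem_Sph {u : ℍ[ℝ]} (hu : u ∈ Sph) : u * star u = 1 := by
  rw [(mem_Sph_iff_star.1 hu).1, mul_neg, (mem_Sph_iff_star.1 hu).2, neg_neg]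

theorem SliceRegular.intrinsicPart {Λ : Set ℍ[ℝ]} (hΛ : IsOpen Λ) (hax : AxSymm Λ)
    {i j : ℍ[ℝ]} (hi : i ∈ Sph) (hj : j ∈ Sph) (hperp : i * j = -(j * i)) {f : ℍ[ℝ] → ℍ[ℝ]}
    (hf : SliceRegular Λ f) : SliceRegular Λ (intrinsicPart i j f) := by
  have key : ∀ u ∈ Sph, SliceRegular Λ (fun q => star u * f (u * q * star u) * u) := fun u hu =>
    hf.conj hΛ hax hi (star_mul_self_of_mem_Sph hu) (mul_star_self_of_mem_Sph hu)
  exact (((hf.add hΛ (key i hi)).add hΛ (key j hj)).add hΛ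
    (key _ (mul_mem_Sph_of_anticomm hi hj hperp))).mul_const hΛ _

theorem intrinsicPart_coe {i j : ℍ[ℝ]} (hi : i ∈ Sph) (hj : j ∈ Sph)
    (hperp : i * j = -(j * i)) (f : ℍ[ℝ] → ℍ[ℝ]) (x : ℝ) :
    ∃ r : ℝ, intrinsicPart i j f x = r := by
  have hx : ∀ u ∈ Sph, u * (x : ℍ[ℝ]) * star u = x := fun u hu => by
    rw [← Quaternion.coe_commutes, mul_assoc, mul_star_self_of_mem_Sph hu, mul_one]
  obtain ⟨hii, hjj, hji, hii', hjj', hji'⟩ := mul_rules_of_anticomm hi hj hperp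
  rw [intrinsicPart, hx i hi, hx j hj, hx _ (mul_mem_Sph_of_anticomm hi hj hperp),
    star_mul_of_anticomm hi hj hperp, (mem_Sph_iff_star.1 hi).1, (mem_Sph_iff_star.1 hj).1]
  generalize f x = a
  refine ⟨_, eq_re_of_commute hi hj hperp ?_ ?_⟩ <;>
  · simp only [Quaternion.mul_coe_eq_smul, mul_smul_comm, smul_mul_assoc]
    congr 1
    simp only [mul_add, add_mul, mul_assoc, neg_mul, mul_neg, hii, hjj, hji, hii', hjj', hji',
      neg_neg, mul_one]
    abel

theorem eq_sum_intrinsicPart {i j : ℍ[ℝ]} (hi : i ∈ Sph) (hj : j ∈ Sph)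
    (hperp : i * j = -(j * i)) (f : ℍ[ℝ] → ℍ[ℝ]) (q : ℍ[ℝ]) :
    f q = intrinsicPart i j f q + intrinsicPart i j (fun p => f p * star i) q * i
      + intrinsicPart i j (fun p => f p * star j) q * j
      + intrinsicPart i j (fun p => f p * star (i * j)) q * (i * j) := by
  obtain ⟨hii, hjj, hji, hii', hjj', hji'⟩ := mul_rules_of_anticomm hi hj hperp
  simp only [intrinsicPart]
  generalize f q = a
  generalize f (i * q * star i) = b
  generalize f (j * q * star j) = c
  generalize f (i * j * q * star (i * j)) = d
  rw [star_mul_of_anticomm hi hj hperp, (mem_Sph_iff_star.1 hi).1, (mem_Sph_iff_star.1 hj).1]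
  simp only [Quaternion.mul_coe_eq_smul, smul_mul_assoc]
  simp only [add_mul, mul_assoc, neg_mul, mul_neg, hii, hjj, hji, hii', hji', neg_neg, mul_one]
  module

theorem eq_zero_of_add_mul_eq_zero {i j : ℍ[ℝ]} (hi : i ∈ Sph) (hj : j ∈ Sph)
    (hperp : i * j = -(j * i)) {a b c d : ℝ}
    (h : (a : ℍ[ℝ]) + b * i + c * j + d * (i * j) = 0) : a = 0 ∧ b = 0 ∧ c = 0 ∧ d = 0 := by
  obtain ⟨hii, hjj, hji, hii', hjj', hji'⟩ := mul_rules_of_anticomm hi hj hperp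
  have hk := (mul_mem_Sph_of_anticomm hi hj hperp).1
  have key : ∀ u, (((a : ℍ[ℝ]) + b * i + c * j + d * (i * j)) * u).re = 0 := fun u => by
    rw [h, zero_mul, Quaternion.re_zero]
  have k0 := key 1
  have k1 := key i
  have k2 := key j
  have k3 := key (i * j)
  simp only [Quaternion.coe_mul_eq_smul, add_mul, smul_mul_assoc, mul_assoc, mul_neg, hii,
    hjj, hji, hii', hji', neg_neg, mul_one, Quaternion.re_add, Quaternion.re_smul,
    Quaternion.re_neg, Quaternion.re_one, Quaternion.re_coe, hi.1, hj.1, hk, smul_eq_mul, mul_zero,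
    add_zero, zero_add, neg_zero, neg_eq_zero] at k0 k1 k2 k3
  exact ⟨k0, k1, k2, k3⟩

theorem QCProp.apply_coe {Λ : Set ℍ[ℝ]} {f : ℍ[ℝ] → ℍ[ℝ]} (hf : QCProp Λ f) {x : ℝ}
    (hx : (x : ℍ[ℝ]) ∈ Λ) : f x = ((f x).re : ℍ[ℝ]) := by
  have h := hf x hx
  rw [Quaternion.star_coe] at h
  exact Quaternion.star_eq_self.1 h.symm

theorem stmt17 (Λ : Set ℍ[ℝ]) (hs : IsSDomain Λ) (hax : AxSymm Λ)
    (i j : ℍ[ℝ]) (hi : i ∈ Sph) (hj : j ∈ Sph) (hperp : i * j = -(j * i))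
    (f : ℍ[ℝ] → ℍ[ℝ]) (hf : SliceRegular Λ f) :
    ∃ f₀ f₁ f₂ f₃ : ℍ[ℝ] → ℍ[ℝ],
      ((SliceRegular Λ f₀ ∧ QCProp Λ f₀) ∧
       (SliceRegular Λ f₁ ∧ QCProp Λ f₁) ∧
       (SliceRegular Λ f₂ ∧ QCProp Λ f₂) ∧
       (SliceRegular Λ f₃ ∧ QCProp Λ f₃) ∧
       ∀ q ∈ Λ, f q = f₀ q + f₁ q * i + f₂ q * j + f₃ q * (i * j)) ∧
      (∀ g₀ g₁ g₂ g₃ : ℍ[ℝ] → ℍ[ℝ],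
        ((SliceRegular Λ g₀ ∧ QCProp Λ g₀) ∧
         (SliceRegular Λ g₁ ∧ QCProp Λ g₁) ∧
         (SliceRegular Λ g₂ ∧ QCProp Λ g₂) ∧
         (SliceRegular Λ g₃ ∧ QCProp Λ g₃) ∧
         ∀ q ∈ Λ, f q = g₀ q + g₁ q * i + g₂ q * j + g₃ q * (i * j)) →
        ∀ q ∈ Λ, g₀ q = f₀ q ∧ g₁ q = f₁ q ∧ g₂ q = f₂ q ∧ g₃ q = f₃ q) := by
  have hC : ∀ g, SliceRegular Λ g → SliceRegular Λ (intrinsicPart i j g) ∧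
      QCProp Λ (intrinsicPart i j g) := fun g hg => by
    have h := hg.intrinsicPart hs.1 hax hi hj hperp
    exact ⟨h, h.qcProp_of_real hs hax hi fun x _ => intrinsicPart_coe hi hj hperp g x⟩
  have hC₀ := hC f hf
  have hC₁ := hC _ (hf.mul_const hs.1 (star i))
  have hC₂ := hC _ (hf.mul_const hs.1 (star j))
  have hC₃ := hC _ (hf.mul_const hs.1 (star (i * j)))
  have hsum := eq_sum_intrinsicPart hi hj hperp f
  refine ⟨_, _, _, _, ⟨hC₀, hC₁, hC₂, hC₃, fun q _ => hsum q⟩, ?_⟩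
  rintro g₀ g₁ g₂ g₃ ⟨hg₀, hg₁, hg₂, hg₃, hg⟩
  have hreal : ∀ x : ℝ, (x : ℍ[ℝ]) ∈ Λ → _ := fun x hx =>
    eq_zero_of_add_mul_eq_zero hi hj hperp
      (a := (g₀ x).re - (intrinsicPart i j f x).re)
      (b := (g₁ x).re - (intrinsicPart i j (fun p => f p * star i) x).re)
      (c := (g₂ x).re - (intrinsicPart i j (fun p => f p * star j) x).re)
      (d := (g₃ x).re - (intrinsicPart i j (fun p => f p * star (i * j)) x).re) (by
        have h := (hg x hx).symm.trans (hsum x)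
        simp only [Quaternion.coe_sub, ← hg₀.2.apply_coe hx, ← hg₁.2.apply_coe hx,
          ← hg₂.2.apply_coe hx, ← hg₃.2.apply_coe hx, ← hC₀.2.apply_coe hx,
          ← hC₁.2.apply_coe hx, ← hC₂.2.apply_coe hx, ← hC₃.2.apply_coe hx]
        rw [← sub_eq_zero] at h
        rw [← h]
        noncomm_ring)
  have key : ∀ g g' : ℍ[ℝ] → ℍ[ℝ], SliceRegular Λ g ∧ QCProp Λ g →
      SliceRegular Λ g' ∧ QCProp Λ g' →
      (∀ x : ℝ, (x : ℍ[ℝ]) ∈ Λ → (g x).re - (g' x).re = 0) → ∀ q ∈ Λ, g q = g' q :=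
    fun g g' hg hg' h q hq => sub_eq_zero.1 <|
      (hg.1.sub hs.1 hg'.1).eq_zero_of_real hs hi (fun x hx => by
        rw [Pi.sub_apply, hg.2.apply_coe hx, hg'.2.apply_coe hx, ← Quaternion.coe_sub, h x hx,
          Quaternion.coe_zero]) q hq
  exact fun q hq => ⟨key _ _ hg₀ hC₀ (fun x hx => (hreal x hx).1) q hq,
    key _ _ hg₁ hC₁ (fun x hx => (hreal x hx).2.1) q hq,
    key _ _ hg₂ hC₂ (fun x hx => (hreal x hx).2.2.1) q hq,
    key _ _ hg₃ hC₃ (fun x hx => (hreal x hx).2.2.2) q hq⟩
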